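/- Let p ≥ 3 and let (a₀,b₀) ∈ ℂ*×ℂ be such that ω_j(a₀,b₀) ≠ 0 for all 2 ≤ j ≤ p−1 and ω_p(a₀,b₀) = 0 (i.e. the marked critical point 0 of f̂_{a₀,b₀} is periodic of period p). Then the function ω_p is defined and holomorphic in a neighborhood of (a₀,b₀) in ℂ², and its gradient there is nonzero: (∂_a ω_p(a₀,b₀), ∂_b ω_p(a₀,b₀)) ≠ (0,0). -/

import Mathlib

noncomputable section

/-- The critical orbit functions for `f̂_{a,b}(z) = 1 + b/z + a/z²`:
`ω_2(a,b) = 1`, `ω_{n+1}(a,b) = 1 + b/ω_n + a/ω_n²`, so `ω_n(a,b) = f̂_{a,b}^{∘n}(0)`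
(the values at `n = 0, 1` are junk). -/
def omAB (a b : ℂ) : ℕ → ℂ
  | 0 => 0
  | n + 1 =>
      if n = 0 then 0
      else if n = 1 then 1
      else 1 + b / omAB a b n + a / (omAB a b n) ^ 2

open MeasureTheory Filter Set Topology Bornology
open scoped ENNReal

theorem lintegral_image_eq_lintegral_enorm_deriv_sq_mul {s : Set ℂ} (hs : MeasurableSet s)
    {f f' : ℂ → ℂ} (hf' : ∀ x ∈ s, HasDerivAt f (f' x) x) (hf : InjOn f s) (g : ℂ → ℝ≥0∞) :
    ∫⁻ w in f '' s, g w = ∫⁻ z in s, ‖f' z‖ₑ ^ 2 * g (f z) := by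
  rw [lintegral_image_eq_lintegral_abs_det_fderiv_mul volume hs
    (fun x hx => ((hf' x hx).hasFDerivAt.restrictScalars ℝ).hasFDerivWithinAt) hf]
  congr! 3 with z
  simp only [ContinuousLinearMap.det, ContinuousLinearMap.coe_restrictScalars,
    LinearMap.det_restrictScalars, Algebra.norm_complex_eq]
  simp [Complex.normSq_eq_norm_sq, ENNReal.ofReal_pow]

theorem lintegral_eq_lintegral_inv (g : ℂ → ℝ≥0∞) :
    ∫⁻ w, g w = ∫⁻ u, ‖(u ^ 2)⁻¹‖ₑ ^ 2 * g u⁻¹ := by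
  have h0 : (({0} : Set ℂ)ᶜ : Set ℂ) =ᵐ[volume] univ := by simp [ae_eq_univ]
  have him : (fun u : ℂ => u⁻¹) '' {0}ᶜ = {0}ᶜ := by
    rw [image_inv_eq_inv]; ext; simp
  have := lintegral_image_eq_lintegral_enorm_deriv_sq_mul
    (measurableSet_singleton (0 : ℂ)).compl (fun x hx => hasDerivAt_inv hx)
    (inv_injective.injOn) g
  rw [him, setLIntegral_congr h0, setLIntegral_congr h0] at this
  simpa using this

theorem lintegral_le_lintegral_rightHalfPlane {a : ℂ} (ha : a ≠ 0) (v : ℂ) (g : ℂ → ℝ≥0∞) :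
    ∫⁻ w, g w ≤ ∫⁻ t in {t : ℂ | 0 < t.re}, ‖2 * a * t‖ₑ ^ 2 * g (v + a * t ^ 2) := by
  set S : Set ℂ := {t : ℂ | 0 < t.re}
  have hS : MeasurableSet S := (isOpen_lt continuous_const Complex.continuous_re).measurableSet
  have hd : ∀ t : ℂ, HasDerivAt (fun t => v + a * t ^ 2) (2 * a * t) t := fun t => by
    convert! ((hasDerivAt_pow 2 t).const_mul a).const_add v using 1
    ring
  have hinj : InjOn (fun t => v + a * t ^ 2) S := by
    intro s hs t ht h
    have : s ^ 2 = t ^ 2 := by simpa [ha] using h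
    rcases sq_eq_sq_iff_eq_or_eq_neg.1 this with h | h
    · exact h
    · simp only [S, mem_ofPred_eq, h, Complex.neg_re] at hs ht
      linarith
  rw [← lintegral_image_eq_lintegral_enorm_deriv_sq_mul hS (fun t _ => hd t) hinj]
  have haxis : volume {t : ℂ | t.re = 0} = 0 := by
    have := Measure.addHaar_submodule (volume : Measure ℂ) (LinearMap.ker Complex.reLm) (by
      rw [Ne, LinearMap.ker_eq_top]
      intro h
      simpa using congrArg (fun l => l 1) h)
    convert! this using 2
  have hnull : volume ((fun t => v + a * t ^ 2) '' {t : ℂ | t.re = 0}) = 0 :=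
    addHaar_image_eq_zero_of_differentiableOn_of_addHaar_eq_zero _
      (fun t _ => ((hd t).differentiableAt.restrictScalars ℝ).differentiableWithinAt) haxis
  have hcover : (univ : Set ℂ) ⊆
      (fun t => v + a * t ^ 2) '' S ∪ (fun t => v + a * t ^ 2) '' {t : ℂ | t.re = 0} := by
    intro w _
    obtain ⟨t, ht⟩ := IsAlgClosed.exists_pow_nat_eq ((w - v) / a) (n := 2) (by norm_num)
    have hw : v + a * t ^ 2 = w := by rw [ht]; field_simp; ring
    rcases lt_trichotomy t.re 0 with h | h | h
    · exact .inl ⟨-t, by simpa [S] using h, by simpa using hw⟩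
    · exact .inr ⟨t, h, hw⟩
    · exact .inl ⟨t, h, hw⟩
  calc ∫⁻ w, g w = ∫⁻ w in univ, g w := by simp
    _ ≤ _ := lintegral_mono_set hcover
    _ ≤ _ := lintegral_union_le _ _ _
    _ = _ := by rw [setLIntegral_measure_zero _ _ hnull, add_zero]

theorem locallyIntegrable_inv_sub (s : ℂ) : LocallyIntegrable (fun z : ℂ => (z - s)⁻¹) := by
  have h : LocallyIntegrable (fun z : ℂ => z⁻¹) :=
    locallyIntegrable_of_norm_le_rpow (α := 1) (C := 1) (by simp) (by simp)
      (by filter_upwards with z; simp [Real.rpow_neg_one]) (by fun_prop)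
  have := locallyIntegrable_map_homeomorph (Homeomorph.subRight s)
    (f := fun z : ℂ => z⁻¹) (μ := volume)
  have hm : Measure.map (Homeomorph.subRight s) (volume : Measure ℂ) = volume :=
    (measurePreserving_sub_right volume s).map_eq
  rw [hm] at this
  exact this.1 h

theorem lintegral_enorm_lt_top_of_integrableOn {q : ℂ → ℂ}
    (hq : IntegrableOn q (Metric.closedBall 0 1))
    (hh : IntegrableOn (fun u => q u⁻¹ / u ^ 4) (Metric.ball 0 1)) :
    ∫⁻ w, ‖q w‖ₑ < ∞ := by
  have him : (Metric.closedBall (0 : ℂ) 1)ᶜ = (fun u : ℂ => u⁻¹) '' (Metric.ball 0 1 \ {0}) := by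
    rw [image_inv_eq_inv]
    ext u
    rcases eq_or_ne u 0 with rfl | hu
    · simp
    · simp [hu, inv_lt_one₀ (norm_pos_iff.2 hu)]
  rw [← lintegral_add_compl _ (Metric.isClosed_closedBall (x := (0 : ℂ)) (ε := 1)).measurableSet,
    him, lintegral_image_eq_lintegral_enorm_deriv_sq_mul
      (Metric.isOpen_ball.measurableSet.diff (measurableSet_singleton 0))
      (fun x hx => hasDerivAt_inv hx.2) inv_injective.injOn]
  refine ENNReal.add_lt_top.2 ⟨hq.2, lt_of_le_of_lt ?_ hh.2⟩
  refine (lintegral_mono_set sdiff_subset).trans (lintegral_mono fun u => le_of_eq ?_)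
  rw [← enorm_pow, ← enorm_mul, enorm_eq_iff_norm_eq]
  simp; ring

/-- An integrable quadratic differential `q dz²` with a simple pole at the critical point `0` is not
fixed by the pushforward under `z ↦ v + a (z⁻¹ + β)²`: the pushforward does not increase the
`L¹` norm, and the two preimages cancel near the critical point, making the inequality strict. -/
theorem false_of_pushforward_eq {a : ℂ} (ha : a ≠ 0) (v β : ℂ) {q : ℂ → ℂ} (hqm : Measurable q)
    (hq : IntegrableOn q (Metric.closedBall 0 1))
    (hh : IntegrableOn (fun u => q u⁻¹ / u ^ 4) (Metric.ball 0 1))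
    (hpush : ∀ᵐ t : ℂ, q (t - β)⁻¹ / (t - β) ^ 4 + q (-t - β)⁻¹ / (-t - β) ^ 4 =
      (2 * a * t) ^ 2 * q (v + a * t ^ 2))
    (hlim : Tendsto (fun z => z * q z) (𝓝[≠] 0) (𝓝 1)) : False := by
  have hJ := lintegral_enorm_lt_top_of_integrableOn hq hh
  set S : Set ℂ := {t : ℂ | 0 < t.re}
  have hSo : IsOpen S := isOpen_lt continuous_const Complex.continuous_re
  set H : ℂ → ℂ := fun t => q (t - β)⁻¹ / (t - β) ^ 4
  have hHm : Measurable H := by fun_prop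
  have hH : ∫⁻ t, ‖H t‖ₑ = ∫⁻ w, ‖q w‖ₑ := by
    rw [lintegral_eq_lintegral_inv (fun w => ‖q w‖ₑ),
      ← lintegral_sub_right_eq_self (fun u => ‖(u ^ 2)⁻¹‖ₑ ^ 2 * ‖q u⁻¹‖ₑ) β]
    refine lintegral_congr fun u => ?_
    rw [← enorm_pow, ← enorm_mul, enorm_eq_iff_norm_eq]
    simp [H]; ring
  have hupper : ∫⁻ t in S, (‖H t‖ₑ + ‖H (-t)‖ₑ) ≤ ∫⁻ w, ‖q w‖ₑ := by
    rw [lintegral_add_left (by fun_prop), ← hH]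
    have hneg : ∫⁻ t in S, ‖H (-t)‖ₑ = ∫⁻ t in -S, ‖H t‖ₑ := by
      have := (Measure.measurePreserving_neg (volume : Measure ℂ)).setLIntegral_comp_preimage_emb
        (MeasurableEquiv.neg ℂ).measurableEmbedding (fun t => ‖H t‖ₑ) (-S)
      rw [← this]
      simp
    rw [hneg, ← lintegral_union hSo.neg.measurableSet]
    · exact setLIntegral_le_lintegral _ _
    · rw [Set.disjoint_left]
      intro t ht ht'
      simp only [S, mem_ofPred_eq, Set.mem_neg, Complex.neg_re] at ht ht'
      linarith
  have hlower : ∫⁻ w, ‖q w‖ₑ ≤ ∫⁻ t in S, ‖H t + H (-t)‖ₑ := by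
    refine (lintegral_le_lintegral_rightHalfPlane ha v _).trans (le_of_eq ?_)
    refine lintegral_congr_ae (ae_restrict_of_ae ?_)
    filter_upwards [hpush] with t ht
    rw [show H t + H (-t) = _ from ht, enorm_mul _ (q _), enorm_pow]
  have hcube : Tendsto (fun t => t ^ 3 * H t) (cobounded ℂ) (𝓝 1) := by
    have h1 : Tendsto (fun t : ℂ => (t - β)⁻¹) (cobounded ℂ) (𝓝[≠] 0) :=
      tendsto_inv₀_cobounded'.comp (tendsto_sub_const_cobounded β)
    have h2 : Tendsto (fun z : ℂ => (1 + β * z) ^ 3 * (z * q z)) (𝓝[≠] 0) (𝓝 1) := by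
      have : Tendsto (fun z : ℂ => (1 + β * z) ^ 3) (𝓝[≠] 0) (𝓝 1) := by
        have : ContinuousAt (fun z : ℂ => (1 + β * z) ^ 3) 0 := by fun_prop
        simpa [ContinuousAt] using this.tendsto.mono_left nhdsWithin_le_nhds
      simpa using this.mul hlim
    refine (h2.comp h1).congr' ?_
    filter_upwards [eventually_ne_cobounded β] with t ht
    have : t - β ≠ 0 := sub_ne_zero.2 ht
    simp only [Function.comp, H]
    field_simp
    ring
  have hcube' : Tendsto (fun t => t ^ 3 * H (-t)) (cobounded ℂ) (𝓝 (-1)) := by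
    refine (hcube.comp (tendsto_neg_cobounded (E := ℂ))).neg.congr fun t => ?_
    simp only [Function.comp]; ring
  have hev : ∀ᶠ t in cobounded ℂ, ‖H t + H (-t)‖ₑ < ‖H t‖ₑ + ‖H (-t)‖ₑ := by
    have h := ((hcube.add hcube').norm).eventually_lt (hcube.norm.add hcube'.norm) (by simp)
    filter_upwards [h] with t ht
    rw [← mul_add, norm_mul, norm_mul, norm_mul, ← mul_add] at ht
    have := lt_of_mul_lt_mul_left ht (norm_nonneg _)
    rw [← ofReal_norm, ← ofReal_norm, ← ofReal_norm, ← ENNReal.ofReal_add (by simp) (by simp)]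
    exact (ENNReal.ofReal_lt_ofReal_iff_of_nonneg (norm_nonneg _)).2 this
  obtain ⟨R, hR⟩ : ∃ R : ℝ, ∀ t : ℂ, R < ‖t‖ → ‖H t + H (-t)‖ₑ < ‖H t‖ₑ + ‖H (-t)‖ₑ := by
    obtain ⟨R, -, hR⟩ := hasBasis_cobounded_norm.eventually_iff.1 hev
    exact ⟨R, fun t ht => hR ht.le⟩
  have hpos : volume.restrict S {t : ℂ | R < ‖t‖} ≠ 0 := by
    have ho : IsOpen {t : ℂ | R < ‖t‖} := isOpen_lt continuous_const continuous_norm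
    rw [Measure.restrict_apply ho.measurableSet]
    refine (ho.inter hSo).measure_ne_zero _ ⟨((|R| + 1 : ℝ) : ℂ), ?_, ?_⟩
    · simp only [mem_ofPred_eq, Complex.norm_real, Real.norm_eq_abs]
      rw [abs_of_pos (by positivity)]
      linarith [le_abs_self R]
    · simp only [S, mem_ofPred_eq, Complex.ofReal_re]
      positivity
  have hle : ∀ t, ‖H t + H (-t)‖ₑ ≤ ‖H t‖ₑ + ‖H (-t)‖ₑ := fun t => enorm_add_le _ _
  have hstrict := lintegral_strict_mono_of_ae_le_of_ae_lt_on (μ := volume.restrict S)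
    (f := fun t => ‖H t + H (-t)‖ₑ) (g := fun t => ‖H t‖ₑ + ‖H (-t)‖ₑ) (by fun_prop)
    (((lintegral_mono hle).trans hupper).trans_lt hJ).ne (.of_forall hle) hpos
    (.of_forall fun t ht => hR t ht)
  exact (hlower.trans_lt (hstrict.trans_le hupper)).false

/-- If the gradient vanished at a periodic parameter, the sum of `c n / (z - x n)` over the critical
orbit would define an integrable quadratic differential fixed by the pushforward. -/
theorem false_of_orbit {a b : ℂ} (ha : a ≠ 0) {m : ℕ} {x c : ℕ → ℂ} (hx0 : x 0 = 1)
    (hxm : x m = 0) (hx : ∀ n < m, x n ≠ 0)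
    (hrec : ∀ n < m, x (n + 1) = 1 + b / x n + a / x n ^ 2)
    (hc : ∀ n < m, c n = c (n + 1) * (-b / x n ^ 2 - 2 * a / x n ^ 3)) (hcm : c m = 1)
    (hA : ∑ n ∈ Finset.range m, c (n + 1) * (1 / x n ^ 2) = 0)
    (hB : ∑ n ∈ Finset.range m, c (n + 1) * (1 / x n) = 0) : False := by
  have hmom1' : ∑ n ∈ Finset.range m, c n * x n = 0 := by
    have : ∀ n ∈ Finset.range m, c n * x n =
        -b * (c (n + 1) * (1 / x n)) + -(2 * a) * (c (n + 1) * (1 / x n ^ 2)) := fun n hn => by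
      have := hx n (Finset.mem_range.1 hn)
      rw [hc n (Finset.mem_range.1 hn)]
      field_simp
      ring
    rw [Finset.sum_congr rfl this, Finset.sum_add_distrib, ← Finset.mul_sum, ← Finset.mul_sum,
      hA, hB]
    ring
  have hmom0 : ∑ n ∈ Finset.range (m + 1), c n = 0 := by
    have h : ∑ n ∈ Finset.range (m + 1), c n * (x n - 1) = 0 := by
      have : ∀ n ∈ Finset.range m, c (n + 1) * (x (n + 1) - 1) =
          b * (c (n + 1) * (1 / x n)) + a * (c (n + 1) * (1 / x n ^ 2)) := fun n hn => by
        rw [hrec n (Finset.mem_range.1 hn)]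
        ring
      rw [Finset.sum_range_succ', Finset.sum_congr rfl this, Finset.sum_add_distrib,
        ← Finset.mul_sum, ← Finset.mul_sum, hA, hB, hx0]
      ring
    simp only [mul_sub, Finset.sum_sub_distrib, mul_one] at h
    rw [Finset.sum_range_succ (fun n => c n * x n), hmom1', hxm] at h
    linear_combination -h
  have hmom2 : ∑ n ∈ Finset.range m, c n * x n ^ 2 = b * c 0 := by
    have : ∀ n ∈ Finset.range m, c n * x n ^ 2 =
        -b * c (n + 1) + -(2 * a) * (c (n + 1) * (1 / x n)) := fun n hn => by
      have := hx n (Finset.mem_range.1 hn)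
      rw [hc n (Finset.mem_range.1 hn)]
      field_simp
      ring
    rw [Finset.sum_congr rfl this, Finset.sum_add_distrib, ← Finset.mul_sum, ← Finset.mul_sum, hB]
    rw [Finset.sum_range_succ'] at hmom0
    linear_combination (-b) * hmom0
  set q : ℂ → ℂ := fun z => ∑ n ∈ Finset.range (m + 1), c n * (z - x n)⁻¹ with hq
  have hinv : ∀ u : ℂ, u ≠ 0 → (∀ n < m, u ≠ (x n)⁻¹) → q u⁻¹ / u ^ 4 =
      b * c 0 * (u - 0)⁻¹ - ∑ n ∈ Finset.range m, c n * x n ^ 2 * (u - (x n)⁻¹)⁻¹ := by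
    intro u hu hun
    have hterm : ∀ n ∈ Finset.range m, c n * (u⁻¹ - x n)⁻¹ / u ^ 4 =
        (c n * x n ^ 2 * u⁻¹ + c n * x n * (u⁻¹) ^ 2 + c n * (u⁻¹) ^ 3) -
          c n * x n ^ 2 * (u - (x n)⁻¹)⁻¹ := fun n hn => by
      have hn := Finset.mem_range.1 hn
      have h0 := hx n hn
      have h1 : u * x n - 1 ≠ 0 := fun h =>
        hun n hn (eq_inv_of_mul_eq_one_left (sub_eq_zero.1 h))
      have h2 : 1 - u * x n ≠ 0 := fun h => h1 (by linear_combination -h)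
      rw [show u⁻¹ - x n = (1 - u * x n) / u by field_simp,
        show u - (x n)⁻¹ = -(1 - u * x n) / x n by field_simp; ring]
      field_simp
      ring
    simp only [hq, Finset.sum_div]
    rw [Finset.sum_range_succ, Finset.sum_congr rfl hterm, Finset.sum_sub_distrib,
      Finset.sum_add_distrib, Finset.sum_add_distrib, ← Finset.sum_mul, ← Finset.sum_mul,
      ← Finset.sum_mul, hmom2, hmom1', hxm, hcm]
    rw [Finset.sum_range_succ, hcm] at hmom0
    rw [eq_neg_of_add_eq_zero_left hmom0]
    field_simp
    ring
  have hqi : LocallyIntegrable q := by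
    simp only [hq]
    refine locallyIntegrable_finsetSum _ fun n _ => ?_
    exact (locallyIntegrable_inv_sub (x n)).smul (c n)
  refine false_of_pushforward_eq ha (1 - b ^ 2 / (4 * a)) (b / (2 * a)) (q := q) (by fun_prop)
    (hqi.integrableOn_isCompact (isCompact_closedBall 0 1)) ?_ ?_ ?_
  · have hi : LocallyIntegrable (fun u : ℂ => b * c 0 * (u - 0)⁻¹ -
        ∑ n ∈ Finset.range m, c n * x n ^ 2 * (u - (x n)⁻¹)⁻¹) :=
      ((locallyIntegrable_inv_sub 0).smul (b * c 0)).sub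
        (locallyIntegrable_finsetSum _ fun n _ =>
          (locallyIntegrable_inv_sub (x n)⁻¹).smul (c n * x n ^ 2))
    refine IntegrableOn.congr_fun_ae ((hi.integrableOn_isCompact
      (isCompact_closedBall 0 1)).mono_set Metric.ball_subset_closedBall) (ae_restrict_of_ae ?_)
    have hne : ∀ᵐ u : ℂ, ∀ n, u ≠ (x n)⁻¹ := ae_all_iff.2 fun n => Measure.ae_ne _ _
    filter_upwards [Measure.ae_ne volume (0 : ℂ), hne] with u hu hun
    exact (hinv u hu fun n _ => hun n).symm
  · have hne : ∀ᵐ t : ℂ, ∀ n, 1 - b ^ 2 / (4 * a) + a * t ^ 2 ≠ x n := by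
      refine ae_all_iff.2 fun n => ?_
      obtain ⟨r, hr⟩ := IsAlgClosed.exists_pow_nat_eq
        ((x n - (1 - b ^ 2 / (4 * a))) / a) (n := 2) (by norm_num)
      filter_upwards [Measure.ae_ne volume r, Measure.ae_ne volume (-r)] with t h1 h2 h
      have : t ^ 2 = r ^ 2 := by
        rw [hr, ← h]
        field_simp
        ring
      exact (sq_eq_sq_iff_eq_or_eq_neg.1 this).elim h1 h2
    filter_upwards [hne] with t ht
    set w := 1 - b ^ 2 / (4 * a) + a * t ^ 2 with hw
    set u := t - b / (2 * a) with hu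
    set u' := -t - b / (2 * a) with hu'
    have hfac : ∀ s, w - (1 + b * s + a * s ^ 2) = -a * (u - s) * (u' - s) := fun s => by
      rw [hw, hu, hu']
      field_simp
      ring
    have hne' : ∀ s n, 1 + b * s + a * s ^ 2 = x n → u - s ≠ 0 ∧ u' - s ≠ 0 := fun s n hs => by
      have := sub_ne_zero.2 (ht n)
      rw [← hs, hfac] at this
      simp_all
    have hpair : ∀ s n, 1 + b * s + a * s ^ 2 = x n →
        (b + 2 * a * s) * ((u - s)⁻¹ + (u' - s)⁻¹) =
          (2 * a * t) ^ 2 * (w - x n)⁻¹ - 4 * a := fun s n hs => by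
      obtain ⟨h1, h2⟩ := hne' s n hs
      have h3 : u + u' = -(b / a) := by rw [hu, hu']; field_simp; ring
      have h4 : 2 * a * t = a * (u - u') := by rw [hu, hu']; ring
      have h5 : b = -a * (u + u') := by rw [h3]; field_simp
      rw [← hs, hfac, h4, h5]
      field_simp
      ring
    have hsucc : ∀ n < m, 1 + b * (x n)⁻¹ + a * (x n)⁻¹ ^ 2 = x (n + 1) := fun n hn => by
      rw [hrec n hn]
      field_simp
    have h0 : 1 + b * 0 + a * 0 ^ 2 = x 0 := by rw [hx0]; ring
    rw [hinv u (by simpa using (hne' 0 0 h0).1)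
        fun n hn => sub_ne_zero.1 (hne' _ _ (hsucc n hn)).1,
      hinv u' (by simpa using (hne' 0 0 h0).2)
        fun n hn => sub_ne_zero.1 (hne' _ _ (hsucc n hn)).2]
    have hterm : ∀ n ∈ Finset.range m,
        c n * x n ^ 2 * (u - (x n)⁻¹)⁻¹ + c n * x n ^ 2 * (u' - (x n)⁻¹)⁻¹ =
          -(c (n + 1) * ((2 * a * t) ^ 2 * (w - x (n + 1))⁻¹ - 4 * a)) := fun n hn => by
      have hn := Finset.mem_range.1 hn
      have : c n * x n ^ 2 = -(c (n + 1) * (b + 2 * a * (x n)⁻¹)) := by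
        have := hx n hn
        rw [hc n hn]
        field_simp
        ring
      rw [← hpair _ _ (hsucc n hn), this]
      ring
    have hsum : (2 * a * t) ^ 2 * q w =
        ∑ n ∈ Finset.range (m + 1), c n * ((2 * a * t) ^ 2 * (w - x n)⁻¹ - 4 * a) := by
      simp only [mul_sub, Finset.sum_sub_distrib]
      rw [← Finset.sum_mul, hmom0, zero_mul, sub_zero, hq, Finset.mul_sum]
      exact Finset.sum_congr rfl fun n _ => by ring
    have hsplit := Finset.sum_congr rfl hterm
    rw [Finset.sum_add_distrib, Finset.sum_neg_distrib] at hsplit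
    rw [hsum, Finset.sum_range_succ', ← hpair 0 0 h0]
    linear_combination -hsplit
  · have h : Tendsto (fun z => z * ∑ n ∈ Finset.range m, c n * (z - x n)⁻¹ + 1)
        (𝓝[≠] 0) (𝓝 1) := by
      have : ContinuousAt (fun z => z * ∑ n ∈ Finset.range m, c n * (z - x n)⁻¹ + 1) 0 := by
        refine (continuousAt_id.mul (tendsto_finsetSum _ fun n hn => ?_)).add continuousAt_const
        have := hx n (Finset.mem_range.1 hn)
        have h' : (0 : ℂ) - x n ≠ 0 := by simpa
        exact ContinuousAt.mul continuousAt_const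
          ((continuousAt_id.sub continuousAt_const).inv₀ h')
      simpa [ContinuousAt] using this.tendsto.mono_left nhdsWithin_le_nhds
    refine h.congr' ?_
    filter_upwards [self_mem_nhdsWithin] with z hz
    have hz : z ≠ 0 := hz
    simp only [hq]
    rw [Finset.sum_range_succ, hcm, hxm]
    field_simp
    ring

theorem omAB_two (a b : ℂ) : omAB a b 2 = 1 := by simp [omAB]

theorem omAB_add_three (a b : ℂ) (n : ℕ) :
    omAB a b (n + 3) = 1 + b / omAB a b (n + 2) + a / omAB a b (n + 2) ^ 2 := by
  rw [omAB]
  simp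

theorem analyticAt_omAB {a₀ b₀ : ℂ} (n : ℕ) (h : ∀ j < n, omAB a₀ b₀ (j + 2) ≠ 0) :
    AnalyticAt ℂ (fun y : ℂ × ℂ => omAB y.1 y.2 (n + 2)) (a₀, b₀) := by
  induction n with
  | zero => simpa only [zero_add, omAB_two] using analyticAt_const
  | succ n ih =>
    have ih := ih fun j hj => h j (hj.trans n.lt_succ_self)
    have hn := h n n.lt_succ_self
    simp only [show n + 1 + 2 = n + 3 from rfl, omAB_add_three]
    exact (analyticAt_const.add (analyticAt_snd.div ih hn)).add
      (analyticAt_fst.div (ih.pow 2) (pow_ne_zero 2 hn))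

theorem eq_sum_of_linear_recurrence {R : Type*} [CommRing R] {A c d e : ℕ → R} {m : ℕ}
    (hA0 : A 0 = 0) (hA : ∀ n < m, A (n + 1) = d n * A n + e n)
    (hc : ∀ n < m, c n = c (n + 1) * d n) (hcm : c m = 1) :
    ∑ n ∈ Finset.range m, c (n + 1) * e n = A m := by
  have : ∀ n ∈ Finset.range m, c (n + 1) * e n = c (n + 1) * A (n + 1) - c n * A n :=
    fun n hn => by
      rw [hA n (Finset.mem_range.1 hn), hc n (Finset.mem_range.1 hn)]
      ring
  rw [Finset.sum_congr rfl this, Finset.sum_range_sub (fun n => c n * A n), hA0, hcm]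
  ring

theorem stmt7 (p : ℕ) (hp : 3 ≤ p) (a₀ b₀ : ℂ) (ha₀ : a₀ ≠ 0)
    (h1 : ∀ j, 2 ≤ j → j ≤ p - 1 → omAB a₀ b₀ j ≠ 0) (h2 : omAB a₀ b₀ p = 0) :
    (∃ U : Set (ℂ × ℂ), IsOpen U ∧ (a₀, b₀) ∈ U ∧
      DifferentiableOn ℂ (fun x : ℂ × ℂ => omAB x.1 x.2 p) U) ∧
    (deriv (fun a => omAB a b₀ p) a₀ ≠ 0 ∨ deriv (fun b => omAB a₀ b p) b₀ ≠ 0) := by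
  obtain ⟨m, rfl⟩ : ∃ m, p = m + 2 := ⟨p - 2, by omega⟩
  have hx : ∀ n < m, omAB a₀ b₀ (n + 2) ≠ 0 := fun n hn => h1 _ (by omega) (by omega)
  have han : ∀ n ≤ m, AnalyticAt ℂ (fun y : ℂ × ℂ => omAB y.1 y.2 (n + 2)) (a₀, b₀) :=
    fun n hn => analyticAt_omAB n fun j hj => hx j (hj.trans_le hn)
  refine ⟨?_, ?_⟩
  · obtain ⟨U, hU, hUo, hmem⟩ := eventually_nhds_iff.1 (han m le_rfl).eventually_analyticAt
    exact ⟨U, hUo, hmem, fun y hy => (hU y hy).differentiableAt.differentiableWithinAt⟩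
  · by_contra! hgrad
    set d : ℕ → ℂ := fun n => -b₀ / omAB a₀ b₀ (n + 2) ^ 2 - 2 * a₀ / omAB a₀ b₀ (n + 2) ^ 3
    have hc : ∀ n < m, ∏ j ∈ Finset.Ico n m, d j = (∏ j ∈ Finset.Ico (n + 1) m, d j) * d n :=
      fun n hn => by rw [Finset.prod_eq_prod_Ico_succ_bot hn, mul_comm]
    have hdera : ∀ n ≤ m, HasDerivAt (fun a => omAB a b₀ (n + 2))
        (deriv (fun a => omAB a b₀ (n + 2)) a₀) a₀ := fun n hn =>
      ((han n hn).differentiableAt.comp (f := fun a => (a, b₀)) a₀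
        (differentiableAt_id.prodMk (differentiableAt_const b₀))).hasDerivAt
    have hderb : ∀ n ≤ m, HasDerivAt (fun b => omAB a₀ b (n + 2))
        (deriv (fun b => omAB a₀ b (n + 2)) b₀) b₀ := fun n hn =>
      ((han n hn).differentiableAt.comp (f := fun b => (a₀, b)) b₀
        ((differentiableAt_const a₀).prodMk differentiableAt_id)).hasDerivAt
    refine false_of_orbit ha₀ (x := fun n => omAB a₀ b₀ (n + 2))
      (c := fun n => ∏ j ∈ Finset.Ico n m, d j) (omAB_two _ _) h2 hx
      (fun n _ => omAB_add_three _ _ _) hc (by simp) ?_ ?_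
    · refine (eq_sum_of_linear_recurrence (A := fun n => deriv (fun a => omAB a b₀ (n + 2)) a₀)
        (c := fun n => ∏ j ∈ Finset.Ico n m, d j) (d := d) (e := fun n => 1 / omAB a₀ b₀ (n + 2) ^ 2)
        (by simp [omAB_two]) (fun n hn => ?_) hc (by simp)).trans hgrad.1
      have hn0 := hx n hn
      have hd := hdera n hn.le
      simp only [show n + 1 + 2 = n + 3 from rfl, omAB_add_three]
      refine ((((hasDerivAt_const a₀ b₀).fun_div hd hn0).const_add 1).fun_add
        ((hasDerivAt_id' a₀).fun_div (hd.fun_pow 2) (pow_ne_zero 2 hn0))).deriv.trans ?_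
      simp only [d]
      field_simp
      ring
    · refine (eq_sum_of_linear_recurrence (A := fun n => deriv (fun b => omAB a₀ b (n + 2)) b₀)
        (c := fun n => ∏ j ∈ Finset.Ico n m, d j) (d := d) (e := fun n => 1 / omAB a₀ b₀ (n + 2))
        (by simp [omAB_two]) (fun n hn => ?_) hc (by simp)).trans hgrad.2
      have hn0 := hx n hn
      have hd := hderb n hn.le
      simp only [show n + 1 + 2 = n + 3 from rfl, omAB_add_three]
      refine ((((hasDerivAt_id' b₀).fun_div hd hn0).const_add 1).fun_add
        ((hasDerivAt_const b₀ a₀).fun_div (hd.fun_pow 2) (pow_ne_zero 2 hn0))).deriv.trans ?_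
      simp only [d]
      field_simp
      ring
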